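/- Let ω > 0. Let φ, f : ℝ → ℝ be real analytic such that the finite limits φ(±∞) = lim_{x→±∞} φ(x) and f(+∞) = lim_{x→+∞} f(x) exist, f is even, lim_{|x|→∞} x⁴ φ⁽⁴⁾(x) = 0 and lim_{|x|→∞} x⁴ f⁽⁴⁾(x) = 0. For λ > 0 define J₁(λ) = (1/(2πλ)) ∫₀^{2π} φ(λ cos t) f(ωλ sin t) cos t dt. Then for each integer k with 0 ≤ k ≤ 4: lim_{λ→+∞} λ^{k+1} J₁^{(k)}(λ) = (−1)^k k! (1/π) (φ(+∞) − φ(−∞)) f(+∞). -/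

import Mathlib

open Filter intervalIntegral

lemma taylor_aux (g : ℝ → ℝ) (hg : ContDiff ℝ 4 g) (c : ℝ)
    (h0 : Tendsto g atTop (nhds c))
    (h4 : Tendsto (fun x : ℝ => x ^ 4 * iteratedDeriv 4 g x) atTop (nhds 0)) (s : ℝ) (hs : 0 < s) :
    Tendsto (fun x : ℝ => s * (x ^ 1 * iteratedDeriv 1 g x) + s ^ 2 / 2 * (x ^ 2 * iteratedDeriv 2 g x)
      + s ^ 3 / 6 * (x ^ 3 * iteratedDeriv 3 g x)) atTop (nhds 0) := by
  have hR : Tendsto (fun x : ℝ => g (x + s * x) - g x -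
      (s * (x ^ 1 * iteratedDeriv 1 g x) + s ^ 2 / 2 * (x ^ 2 * iteratedDeriv 2 g x)
      + s ^ 3 / 6 * (x ^ 3 * iteratedDeriv 3 g x))) atTop (nhds 0) := by
    rw [Metric.tendsto_atTop] at h4 ⊢
    intro ε hε
    obtain ⟨N, hN⟩ := h4 (ε / (s ^ 4)) (by positivity)
    refine ⟨max N 1, fun x hx => ?_⟩
    have hxN : N ≤ x := (le_max_left _ _).trans hx
    have hx1 : 1 ≤ x := (le_max_right _ _).trans hx
    have hx0 : 0 < x := by linarith
    have hsx : 0 < s * x := by positivity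
    have hlt : x < x + s * x := by linarith
    obtain ⟨ξ, hξ, he⟩ := taylor_mean_remainder_lagrange_iteratedDeriv (f := g) (n := 3) hlt.ne
      (by norm_num; exact hg.contDiffOn)
    rw [Set.uIoo_of_le hlt.le] at hξ
    have hu : UniqueDiffOn ℝ (Set.uIcc x (x + s * x)) := uniqueDiffOn_uIcc hlt.ne
    have hm : x ∈ Set.uIcc x (x + s * x) := Set.left_mem_uIcc
    have e : ∀ m : ℕ, m ≤ 4 → iteratedDerivWithin m g (Set.uIcc x (x + s * x)) x
        = iteratedDeriv m g x := fun m hm4 =>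
      iteratedDerivWithin_eq_iteratedDeriv hu ((hg.of_le (by exact_mod_cast hm4)).contDiffAt) hm
    simp only [taylorWithinEval_succ, taylor_within_zero_eval] at he
    simp only [zero_add, Nat.reduceAdd] at he
    rw [e 1 (by norm_num), e 2 (by norm_num), e 3 (by norm_num)] at he
    have hq : g (x + s * x) - g x -
      (s * (x ^ 1 * iteratedDeriv 1 g x) + s ^ 2 / 2 * (x ^ 2 * iteratedDeriv 2 g x)
      + s ^ 3 / 6 * (x ^ 3 * iteratedDeriv 3 g x)) = iteratedDeriv 4 g ξ * (s * x) ^ 4 / 24 := by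
      norm_num [Nat.factorial] at he
      norm_num
      linear_combination he
    rw [hq]
    have hξ1 := hN ξ (hxN.trans hξ.1.le)
    rw [Real.dist_eq, sub_zero, abs_mul] at hξ1
    rw [Real.dist_eq, sub_zero, abs_div, abs_mul, abs_of_pos (show (0:ℝ) < 24 by norm_num),
      abs_of_pos (show 0 < (s * x) ^ 4 by positivity)]
    rw [abs_of_pos (show 0 < ξ ^ 4 by have := hξ.1; have : 0 < ξ := by linarith
                                      positivity), lt_div_iff₀ (by positivity)] at hξ1
    have h3 : x ^ 4 ≤ ξ ^ 4 := pow_le_pow_left₀ hx0.le hξ.1.le 4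
    have h5 : |iteratedDeriv 4 g ξ| * (s * x) ^ 4 ≤ ξ ^ 4 * |iteratedDeriv 4 g ξ| * s ^ 4 := by
      have : |iteratedDeriv 4 g ξ| * (s * x) ^ 4 = x ^ 4 * |iteratedDeriv 4 g ξ| * s ^ 4 := by ring
      rw [this]; gcongr
    rw [div_lt_iff₀ (by norm_num)]
    linarith
  have h1 : Tendsto (fun x : ℝ => x + s * x) atTop atTop :=
    tendsto_id.atTop_add_atTop (tendsto_id.const_mul_atTop hs)
  have := ((h0.comp h1).sub h0).sub hR
  simp only [sub_self] at this
  refine this.congr fun x => ?_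
  simp only [Function.comp]; ring

lemma decay_top (g : ℝ → ℝ) (hg : ContDiff ℝ 4 g) (c : ℝ)
    (h0 : Tendsto g atTop (nhds c))
    (h4 : Tendsto (fun x : ℝ => x ^ 4 * iteratedDeriv 4 g x) atTop (nhds 0)) (i : ℕ) (hi : i ≤ 4) :
    Tendsto (fun x : ℝ => x ^ i * iteratedDeriv i g x) atTop (nhds (if i = 0 then c else 0)) := by
  have a1 := taylor_aux g hg c h0 h4 1 (by norm_num)
  have a2 := taylor_aux g hg c h0 h4 2 (by norm_num)
  have a3 := taylor_aux g hg c h0 h4 3 (by norm_num)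
  interval_cases i
  · simpa using h0
  · have := ((a1.const_mul 3).add (a2.const_mul (-3/2))).add (a3.const_mul (1/3))
    simp only [mul_zero, add_zero] at this
    simp only [one_ne_zero, if_false]
    exact this.congr fun x => by ring
  · have := ((a1.const_mul (-5)).add (a2.const_mul (4))).add (a3.const_mul (-1))
    simp only [mul_zero, add_zero] at this
    simp only [OfNat.ofNat_ne_zero, if_false]
    exact this.congr fun x => by ring
  · have := ((a1.const_mul (3)).add (a2.const_mul (-3))).add (a3.const_mul (1))
    simp only [mul_zero, add_zero] at this
    simp only [OfNat.ofNat_ne_zero, if_false]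
    exact this.congr fun x => by ring
  · simpa using h4

lemma decay_bot (g : ℝ → ℝ) (hg : ContDiff ℝ 4 g) (c : ℝ)
    (h0 : Tendsto g atBot (nhds c))
    (h4 : Tendsto (fun x : ℝ => x ^ 4 * iteratedDeriv 4 g x) atBot (nhds 0)) (i : ℕ) (hi : i ≤ 4) :
    Tendsto (fun x : ℝ => x ^ i * iteratedDeriv i g x) atBot (nhds (if i = 0 then c else 0)) := by
  have key : ∀ (m : ℕ) (x : ℝ), x ^ m * iteratedDeriv m (fun x => g (-x)) x
      = (-x) ^ m * iteratedDeriv m g (-x) := by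
    intro m x
    rw [iteratedDeriv_comp_neg, smul_eq_mul, neg_pow x m]; ring
  have := decay_top (fun x => g (-x)) (hg.comp contDiff_neg) c (h0.comp tendsto_neg_atTop_atBot)
    (by simp only [key]; exact h4.comp tendsto_neg_atTop_atBot) i hi
  simp only [key] at this
  have := this.comp tendsto_neg_atBot_atTop
  simpa [Function.comp_def] using this

lemma bdd_aux (g : ℝ → ℝ) (hg : Continuous g) (a b : ℝ) (ht : Tendsto g atTop (nhds a))
    (hb : Tendsto g atBot (nhds b)) : ∃ C : ℝ, 0 ≤ C ∧ ∀ x, |g x| ≤ C := by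
  have e1 : ∀ᶠ x in atTop, |g x| ≤ |a| + 1 := (ht.abs.eventually (gt_mem_nhds (lt_add_one |a|))).mono fun x h => h.le
  have e2 : ∀ᶠ x in atBot, |g x| ≤ |b| + 1 := (hb.abs.eventually (gt_mem_nhds (lt_add_one |b|))).mono fun x h => h.le
  obtain ⟨M, hM⟩ := eventually_atTop.1 e1
  obtain ⟨m, hm⟩ := eventually_atBot.1 e2
  obtain ⟨D, hD⟩ := (isCompact_Icc (a := m) (b := M)).exists_bound_of_continuousOn hg.continuousOn
  refine ⟨max (max (|a| + 1) (|b| + 1)) D, le_max_of_le_left (le_max_of_le_left (by positivity)), fun x => ?_⟩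
  rcases le_total M x with h | h
  · exact (hM x h).trans (by simp)
  rcases le_total x m with h' | h'
  · exact (hm x h').trans (by simp)
  · exact (hD x ⟨h', h⟩).trans (by simp)

noncomputable def Fker (φ f : ℝ → ℝ) (ω : ℝ) (i j : ℕ) (l t : ℝ) : ℝ :=
  Real.cos t ^ i * (ω * Real.sin t) ^ j * iteratedDeriv i φ (l * Real.cos t) *
    iteratedDeriv j f (ω * l * Real.sin t) * Real.cos t

noncomputable def Kint (φ f : ℝ → ℝ) (ω : ℝ) (i j : ℕ) (l : ℝ) : ℝ :=
  ∫ t in (0 : ℝ)..(2 * Real.pi), Fker φ f ω i j l t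

lemma Fker_cont (φ f : ℝ → ℝ) (ω : ℝ) (hφ : ∀ n : ℕ, ContDiff ℝ n φ) (hf : ∀ n : ℕ, ContDiff ℝ n f)
    (i j : ℕ) : Continuous (fun p : ℝ × ℝ => Fker φ f ω i j p.1 p.2) := by
  have h1 := (hφ i).continuous_iteratedDeriv' i
  have h2 := (hf j).continuous_iteratedDeriv' j
  unfold Fker
  fun_prop

lemma Fker_deriv (φ f : ℝ → ℝ) (ω : ℝ) (hφ : ∀ n : ℕ, ContDiff ℝ n φ) (hf : ∀ n : ℕ, ContDiff ℝ n f)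
    (i j : ℕ) (l t : ℝ) : HasDerivAt (fun l => Fker φ f ω i j l t)
    (Fker φ f ω (i+1) j l t + Fker φ f ω i (j+1) l t) l := by
  have h1 : HasDerivAt (iteratedDeriv i φ) (iteratedDeriv (i+1) φ (l * Real.cos t)) (l * Real.cos t) := by
    rw [iteratedDeriv_succ]
    exact ((hφ (i+1)).differentiable_iteratedDeriv' i _).hasDerivAt
  have h2 : HasDerivAt (iteratedDeriv j f) (iteratedDeriv (j+1) f (ω * l * Real.sin t)) (ω * l * Real.sin t) := by
    rw [iteratedDeriv_succ]
    exact ((hf (j+1)).differentiable_iteratedDeriv' j _).hasDerivAt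
  have h3 : HasDerivAt (fun l : ℝ => l * Real.cos t) (Real.cos t) l := by
    simpa using (hasDerivAt_id l).mul_const (Real.cos t)
  have h4 : HasDerivAt (fun l : ℝ => ω * l * Real.sin t) (ω * Real.sin t) l := by
    simpa using ((hasDerivAt_id l).const_mul ω).mul_const (Real.sin t)
  have := ((((h1.comp l h3).const_mul (Real.cos t ^ i * (ω * Real.sin t) ^ j)).mul (h2.comp l h4)).mul_const (Real.cos t))
  refine this.congr_deriv ?_
  simp only [Fker, Function.comp]
  ring

lemma Kint_deriv (φ f : ℝ → ℝ) (ω : ℝ) (hφ : ∀ n : ℕ, ContDiff ℝ n φ) (hf : ∀ n : ℕ, ContDiff ℝ n f)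
    (i j : ℕ) (l : ℝ) : HasDerivAt (Kint φ f ω i j)
    (Kint φ f ω (i+1) j l + Kint φ f ω i (j+1) l) l := by
  have c0 := Fker_cont φ f ω hφ hf i j
  have c1 := Fker_cont φ f ω hφ hf (i+1) j
  have c2 := Fker_cont φ f ω hφ hf i (j+1)
  have sec : ∀ {G : ℝ → ℝ → ℝ}, Continuous (fun p : ℝ × ℝ => G p.1 p.2) → ∀ l, Continuous (G l) :=
    fun h l => h.comp (by fun_prop : Continuous fun t : ℝ => (l, t))
  have c3 := c1.add c2
  obtain ⟨D, hD⟩ := ((isCompact_Icc (a := l - 1) (b := l + 1)).prod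
    (isCompact_Icc (a := 0) (b := 2 * Real.pi))).exists_bound_of_continuousOn c3.continuousOn
  have := (intervalIntegral.hasDerivAt_integral_of_dominated_loc_of_deriv_le (μ := MeasureTheory.volume)
    (a := 0) (b := 2 * Real.pi) (F := Fker φ f ω i j)
    (F' := fun l t => Fker φ f ω (i+1) j l t + Fker φ f ω i (j+1) l t) (x₀ := l)
    (s := Set.Icc (l-1) (l+1)) (bound := fun _ => D)
    (Icc_mem_nhds (by linarith) (by linarith))
    (Eventually.of_forall fun x => (sec c0 x).aestronglyMeasurable)
    ((sec c0 l).intervalIntegrable _ _)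
    (((sec c1 l).add (sec c2 l)).aestronglyMeasurable)
    (Eventually.of_forall fun t ht x hx => by
      rw [Set.uIoc_of_le (by positivity)] at ht
      exact hD (x, t) ⟨hx, ht.1.le, ht.2⟩)
    (by simp)
    (Eventually.of_forall fun t ht x hx => Fker_deriv φ f ω hφ hf i j x t)).2
  rw [intervalIntegral.integral_add ((sec c1 l).intervalIntegrable _ _)
    ((sec c2 l).intervalIntegrable _ _)] at this
  exact this

lemma Kint_deriv' (φ f : ℝ → ℝ) (ω : ℝ) (hφ : ∀ n : ℕ, ContDiff ℝ n φ) (hf : ∀ n : ℕ, ContDiff ℝ n f)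
    (i j : ℕ) : deriv (Kint φ f ω i j) = Kint φ f ω (i+1) j + Kint φ f ω i (j+1) :=
  funext fun l => (Kint_deriv φ f ω hφ hf i j l).deriv

lemma Kint_contDiff (φ f : ℝ → ℝ) (ω : ℝ) (hφ : ∀ n : ℕ, ContDiff ℝ n φ) (hf : ∀ n : ℕ, ContDiff ℝ n f)
    (n : ℕ) : ∀ i j, ContDiff ℝ n (Kint φ f ω i j) := by
  induction n with
  | zero => intro i j; exact contDiff_zero.2 (continuous_iff_continuousAt.2
              fun l => (Kint_deriv φ f ω hφ hf i j l).continuousAt)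
  | succ n ih =>
    intro i j
    push_cast
    rw [contDiff_succ_iff_deriv]
    refine ⟨fun l => (Kint_deriv φ f ω hφ hf i j l).differentiableAt, by simp, ?_⟩
    rw [Kint_deriv' φ f ω hφ hf]
    exact (ih _ _).add (ih _ _)

lemma int_abs_cos : ∫ t in (0 : ℝ)..(2 * Real.pi), |Real.cos t| = 4 := by
  have hp := Real.pi_pos
  have hi : ∀ a b : ℝ, IntervalIntegrable (fun t => |Real.cos t|) MeasureTheory.volume a b :=
    fun a b => (Real.continuous_cos.abs).intervalIntegrable _ _
  rw [← intervalIntegral.integral_add_adjacent_intervals (hi 0 (Real.pi/2)) (hi _ _),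
    ← intervalIntegral.integral_add_adjacent_intervals (hi (Real.pi/2) (3*Real.pi/2)) (hi _ _)]
  have h1 : ∫ t in (0 : ℝ)..(Real.pi/2), |Real.cos t| = ∫ t in (0 : ℝ)..(Real.pi/2), Real.cos t := by
    refine intervalIntegral.integral_congr fun t ht => ?_
    rw [Set.uIcc_of_le (by positivity)] at ht
    exact abs_of_nonneg (Real.cos_nonneg_of_mem_Icc ⟨by linarith [ht.1], ht.2⟩)
  have h2 : ∫ t in (Real.pi/2)..(3*Real.pi/2), |Real.cos t| = ∫ t in (Real.pi/2)..(3*Real.pi/2), -Real.cos t := by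
    refine intervalIntegral.integral_congr fun t ht => ?_
    rw [Set.uIcc_of_le (by linarith)] at ht
    exact abs_of_nonpos (Real.cos_nonpos_of_pi_div_two_le_of_le ht.1 (by linarith [ht.2]))
  have h3 : ∫ t in (3*Real.pi/2)..(2*Real.pi), |Real.cos t| = ∫ t in (3*Real.pi/2)..(2*Real.pi), Real.cos t := by
    refine intervalIntegral.integral_congr fun t ht => ?_
    rw [Set.uIcc_of_le (by linarith)] at ht
    have : 0 ≤ Real.cos (t - 2 * Real.pi) :=
      Real.cos_nonneg_of_mem_Icc ⟨by linarith [ht.1], by linarith [ht.2]⟩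
    rw [Real.cos_sub_two_pi] at this
    exact abs_of_nonneg this
  have hs : Real.sin (3 * Real.pi / 2) = -1 := by
    rw [show 3 * Real.pi / 2 = Real.pi / 2 + Real.pi by ring, Real.sin_add_pi, Real.sin_pi_div_two]
  rw [h1, h2, h3, intervalIntegral.integral_neg, integral_cos, integral_cos, integral_cos, hs]
  simp
  norm_num

lemma ae_trig : ∀ᵐ t : ℝ, Real.cos t ≠ 0 ∧ Real.sin t ≠ 0 := by
  have hs : {t : ℝ | ¬ (Real.cos t ≠ 0 ∧ Real.sin t ≠ 0)} ⊆ Set.range (fun n : ℤ => (n : ℝ) * (Real.pi / 2)) := by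
    intro t ht
    simp only [Set.mem_ofPred_eq, not_and_or, not_not] at ht
    rcases ht with h | h
    · obtain ⟨k, hk⟩ := Real.cos_eq_zero_iff.1 h
      exact ⟨2 * k + 1, by simp only [hk]; push_cast; ring⟩
    · obtain ⟨k, hk⟩ := Real.sin_eq_zero_iff.1 h
      exact ⟨2 * k, by simp only [← hk]; push_cast; ring⟩
  exact ((Set.countable_range _).mono hs).measure_zero _

lemma dct (P Q : ℝ → ℝ) (hP : Continuous P) (hQ : Continuous Q) (ω : ℝ) (hω : 0 < ω)
    (pp pm q : ℝ) (h1 : Tendsto P atTop (nhds pp)) (h2 : Tendsto P atBot (nhds pm))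
    (h3 : Tendsto Q atTop (nhds q)) (h4 : Tendsto Q atBot (nhds q)) :
    Tendsto (fun l : ℝ => ∫ t in (0 : ℝ)..(2 * Real.pi), P (l * Real.cos t) * Q (ω * l * Real.sin t) * Real.cos t)
      atTop (nhds (2 * (pp - pm) * q)) := by
  obtain ⟨C, hC0, hC⟩ := bdd_aux P hP _ _ h1 h2
  obtain ⟨D, hD0, hD⟩ := bdd_aux Q hQ _ _ h3 h4
  have hlim : ∫ t in (0 : ℝ)..(2 * Real.pi), ((pp + pm) / 2 * q * Real.cos t + (pp - pm) / 2 * q * |Real.cos t|)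
      = 2 * (pp - pm) * q := by
    rw [intervalIntegral.integral_add (Continuous.intervalIntegrable (by fun_prop) _ _)
      (Continuous.intervalIntegrable (by fun_prop) _ _), intervalIntegral.integral_const_mul,
      intervalIntegral.integral_const_mul, int_abs_cos, integral_cos]
    simp; ring
  rw [← hlim]
  refine intervalIntegral.tendsto_integral_filter_of_dominated_convergence (fun _ => C * D)
    (Eventually.of_forall fun l => Continuous.aestronglyMeasurable (by fun_prop))
    (Eventually.of_forall fun l => Eventually.of_forall fun t _ => ?_) (by simp) ?_
  · rw [Real.norm_eq_abs, abs_mul, abs_mul]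
    calc _ ≤ C * D * 1 := by
          gcongr
          · exact hC _
          · exact hD _
          · exact Real.abs_cos_le_one t
      _ = C * D := by ring
  · filter_upwards [ae_trig] with t ht _
    have hq : Tendsto (fun l : ℝ => Q (ω * l * Real.sin t)) atTop (nhds q) := by
      rcases lt_or_gt_of_ne ht.2 with h | h
      · exact h4.comp ((tendsto_id.const_mul_atTop hω).atTop_mul_const_of_neg h)
      · exact h3.comp ((tendsto_id.const_mul_atTop hω).atTop_mul_const h)
    rcases lt_or_gt_of_ne ht.1 with h | h
    · have := ((h2.comp (tendsto_id.atTop_mul_const_of_neg h)).mul hq).mul_const (Real.cos t)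
      convert this using 2
      · rfl
      · rw [abs_of_neg h]; ring
    · have := ((h1.comp (tendsto_id.atTop_mul_const h)).mul hq).mul_const (Real.cos t)
      convert this using 2
      · rfl
      · rw [abs_of_pos h]; ring

theorem stmt_17 (ω : ℝ) (hω : 0 < ω) (φ f : ℝ → ℝ)
    (hφanal : ∀ x : ℝ, AnalyticAt ℝ φ x) (hfanal : ∀ x : ℝ, AnalyticAt ℝ f x)
    (hfeven : ∀ s : ℝ, f (-s) = f s)
    (φp φm fp : ℝ)
    (hφp : Tendsto φ atTop (nhds φp)) (hφm : Tendsto φ atBot (nhds φm))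
    (hfp : Tendsto f atTop (nhds fp))
    (hφ4top : Tendsto (fun x : ℝ => x ^ 4 * iteratedDeriv 4 φ x) atTop (nhds 0))
    (hφ4bot : Tendsto (fun x : ℝ => x ^ 4 * iteratedDeriv 4 φ x) atBot (nhds 0))
    (hf4top : Tendsto (fun x : ℝ => x ^ 4 * iteratedDeriv 4 f x) atTop (nhds 0))
    (hf4bot : Tendsto (fun x : ℝ => x ^ 4 * iteratedDeriv 4 f x) atBot (nhds 0))
    (J₁ : ℝ → ℝ)
    (hJ₁ : ∀ l : ℝ, J₁ l =
      (1 / (2 * Real.pi * l)) *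
        ∫ t in (0 : ℝ)..(2 * Real.pi), φ (l * Real.cos t) * f (ω * l * Real.sin t) * Real.cos t) :
    ∀ k : ℕ, k ≤ 4 →
      Tendsto (fun l : ℝ => l ^ (k + 1) * iteratedDeriv k J₁ l) atTop
        (nhds ((-1 : ℝ) ^ k * (Nat.factorial k) * (1 / Real.pi) * (φp - φm) * fp)) := by
  have hφ : ∀ n : ℕ, ContDiff ℝ n φ := fun n => contDiff_iff_contDiffAt.2 fun x => (hφanal x).contDiffAt
  have hf : ∀ n : ℕ, ContDiff ℝ n f := fun n => contDiff_iff_contDiffAt.2 fun x => (hfanal x).contDiffAt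
  have hfm : Tendsto f atBot (nhds fp) := by
    have := hfp.comp tendsto_neg_atBot_atTop
    exact this.congr fun x => hfeven x
  have hpi := Real.pi_pos
  -- base limits
  have base : ∀ i j : ℕ, i + j ≤ 4 → Tendsto (fun l : ℝ => l ^ (i + j) * Kint φ f ω i j l) atTop
      (nhds (if i + j = 0 then 2 * (φp - φm) * fp else 0)) := by
    intro i j hij
    have c1 := (hφ i).continuous_iteratedDeriv' i
    have c2 := (hf j).continuous_iteratedDeriv' j
    have := dct (fun x => x ^ i * iteratedDeriv i φ x) (fun x => x ^ j * iteratedDeriv j f x)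
      (by fun_prop) (by fun_prop) ω hω _ _ _
      (decay_top φ (hφ 4) φp hφp hφ4top i (by omega)) (decay_bot φ (hφ 4) φm hφm hφ4bot i (by omega))
      (decay_top f (hf 4) fp hfp hf4top j (by omega)) (decay_bot f (hf 4) fp hfm hf4bot j (by omega))
    have e : (2 * ((if i = 0 then φp else 0) - (if i = 0 then φm else 0)) * (if j = 0 then fp else 0))
      = if i + j = 0 then 2 * (φp - φm) * fp else 0 := by
      rcases i with _ | i <;> rcases j with _ | j <;> simp
    rw [e] at this
    refine this.congr fun l => ?_
    rw [Kint, ← intervalIntegral.integral_const_mul]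
    congr 1
    funext t
    simp only [Fker]
    ring
  have step : ∀ k i j : ℕ, i + j + k ≤ 4 →
      Tendsto (fun l : ℝ => l ^ (i + j + k) * iteratedDeriv k (Kint φ f ω i j) l) atTop
      (nhds (if i + j + k = 0 then 2 * (φp - φm) * fp else 0)) := by
    intro k
    induction k with
    | zero => intro i j h; simpa using base i j h
    | succ k ih =>
      intro i j h
      have h1 := ih (i+1) j (by omega)
      have h2 := ih i (j+1) (by omega)
      rw [if_neg (by omega)] at h1 h2 ⊢
      have := h1.add h2
      rw [add_zero] at this
      refine this.congr fun l => ?_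
      rw [iteratedDeriv_succ', Kint_deriv' φ f ω hφ hf, iteratedDeriv_add
        (Kint_contDiff φ f ω hφ hf k _ _).contDiffAt (Kint_contDiff φ f ω hφ hf k _ _).contDiffAt]
      rw [show i + 1 + j + k = i + j + (k + 1) by ring, show i + (j + 1) + k = i + j + (k + 1) by ring]
      ring
  set I := Kint φ f ω 0 0 with hI
  have hIc : ∀ n : ℕ, ContDiff ℝ n I := fun n => Kint_contDiff φ f ω hφ hf n 0 0
  have hJI : J₁ = fun l => (1 / (2 * Real.pi * l)) * I l := by
    funext l
    rw [hJ₁, hI, Kint]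
    simp [Fker]
  have hJc : ∀ n : ℕ, ∀ l : ℝ, 0 < l → ContDiffAt ℝ n J₁ l := by
    intro n l hl
    rw [hJI]
    refine ContDiffAt.mul ?_ (hIc n).contDiffAt
    exact contDiffAt_const.div (by fun_prop) (by positivity)
  have hJd : ∀ n : ℕ, ∀ l : ℝ, 0 < l → HasDerivAt (iteratedDeriv n J₁) (iteratedDeriv (n+1) J₁ l) l := by
    intro n l hl
    rw [iteratedDeriv_succ]
    apply DifferentiableAt.hasDerivAt
    have := (hJc (n+1) l hl).contDiffWithinAt (s := Set.univ)
    have := this.differentiableWithinAt_iteratedDerivWithin (m := n) (by norm_cast; omega)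
      (by simp)
    rwa [iteratedDerivWithin_univ, differentiableWithinAt_univ] at this
  have hId : ∀ n : ℕ, ∀ l : ℝ, HasDerivAt (iteratedDeriv n I) (iteratedDeriv (n+1) I l) l := by
    intro n l
    rw [iteratedDeriv_succ]
    exact ((hIc (n+1)).differentiable_iteratedDeriv' n _).hasDerivAt
  have rel0 : ∀ l : ℝ, 0 < l → l * J₁ l = 1 / (2 * Real.pi) * I l := by
    intro l hl
    rw [hJI]; field_simp
  have rel : ∀ k : ℕ, ∀ l : ℝ, 0 < l → l * iteratedDeriv (k+1) J₁ l + (k+1) * iteratedDeriv k J₁ l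
      = 1 / (2 * Real.pi) * iteratedDeriv (k+1) I l := by
    intro k
    induction k with
    | zero =>
      intro l hl
      have d1 := (hasDerivAt_id l).mul (hJd 0 l hl)
      have d2 := (hId 0 l).const_mul (1 / (2 * Real.pi))
      have := (d1.congr_of_eventuallyEq (f₁ := fun l => 1 / (2 * Real.pi) * iteratedDeriv 0 I l) (by
        filter_upwards [lt_mem_nhds hl] with x hx
        simpa using (rel0 x hx).symm)).unique d2
      rw [← this]; simp; ring
    | succ k ih =>
      intro l hl
      have d1 := ((hasDerivAt_id l).mul (hJd (k+1) l hl)).add ((hJd k l hl).const_mul ((k:ℝ)+1))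
      have d2 := (hId (k+1) l).const_mul (1 / (2 * Real.pi))
      have := (d1.congr_of_eventuallyEq (f₁ := fun l => 1 / (2 * Real.pi) * iteratedDeriv (k+1) I l) (by
        filter_upwards [lt_mem_nhds hl] with x hx
        simpa using (ih x hx).symm)).unique d2
      rw [← this]; simp; ring
  intro k
  induction k with
  | zero =>
    intro _
    have := (step 0 0 0 (by norm_num)).const_mul (1 / (2 * Real.pi))
    simp only [add_zero, if_true, pow_zero, one_mul, iteratedDeriv_zero] at this
    have e : (1 / (2 * Real.pi) * (2 * (φp - φm) * fp)) =
      (-1 : ℝ) ^ 0 * (Nat.factorial 0) * (1 / Real.pi) * (φp - φm) * fp := by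
      simp; field_simp
    rw [e] at this
    refine this.congr' ?_
    filter_upwards [eventually_gt_atTop 0] with l hl
    rw [← rel0 l hl]; simp
  | succ k ih =>
    intro hk
    have h1 := ih (by omega)
    have h2 := (step (k+1) 0 0 (by omega)).const_mul (1 / (2 * Real.pi))
    rw [if_neg (by omega)] at h2
    have := h2.sub (h1.const_mul ((k:ℝ)+1))
    have e : 1 / (2 * Real.pi) * 0 - ((k:ℝ)+1) * ((-1 : ℝ) ^ k * (Nat.factorial k) * (1 / Real.pi) * (φp - φm) * fp)
      = (-1 : ℝ) ^ (k+1) * (Nat.factorial (k+1)) * (1 / Real.pi) * (φp - φm) * fp := by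
      rw [Nat.factorial_succ]; push_cast; ring
    rw [e] at this
    refine this.congr' ?_
    filter_upwards [eventually_gt_atTop 0] with l hl
    have := rel k l hl
    rw [show 0 + 0 + (k + 1) = k + 1 by ring]
    linear_combination (-l ^ (k+1)) * this
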